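/- Let X be a real Banach space, canonically embedded in its bidual X**. Every w*-denting point of the closed unit ball B_{X**} (with respect to the weak* topology σ(X**, X*)) belongs to the canonical image of X in X**. -/

import Mathlib

/-- The w*-slice of the closed dual unit ball `B_{X*}` determined by `x ∈ X` and `α > 0`:
`{f ∈ B_{X*} : f x > 1 - α}`. -/
def wStarSlice (X : Type*) [NormedAddCommGroup X] [NormedSpace ℝ X] (x : X) (α : ℝ) :
    Set (X →L[ℝ] ℝ) :=
  {f | ‖f‖ ≤ 1 ∧ 1 - α < f x}

/-- `f` is a w*-denting point of the closed dual unit ball `B_{X*}`: for every `ε > 0`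
there is a w*-slice of `B_{X*}` containing `f` of diameter `< ε`. -/
def IsWStarDentingPoint {X : Type*} [NormedAddCommGroup X] [NormedSpace ℝ X]
    (f : X →L[ℝ] ℝ) : Prop :=
  ‖f‖ ≤ 1 ∧ ∀ ε > 0, ∃ (x : X) (α : ℝ), ‖x‖ = 1 ∧ 0 < α ∧
    f ∈ wStarSlice X x α ∧ Metric.diam (wStarSlice X x α) < ε

/-- The slices of the closed dual unit ball are norm bounded. -/
theorem isBounded_wStarSlice {X : Type*} [NormedAddCommGroup X] [NormedSpace ℝ X]
    (x : X) (α : ℝ) : Bornology.IsBounded (wStarSlice X x α) :=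
  (isBounded_iff_forall_norm_le).2 ⟨1, fun _ hf => hf.1⟩

/-- A w*-slice of the bidual unit ball given by a norm-one functional meets the canonical image. -/
theorem exists_inclusionInDoubleDual_mem_wStarSlice
    {X : Type*} [NormedAddCommGroup X] [NormedSpace ℝ X] {f : StrongDual ℝ X}
    (hf : ‖f‖ = 1) {α : ℝ} (hα : 0 < α) :
    ∃ x : X, NormedSpace.inclusionInDoubleDual ℝ X x ∈ wStarSlice (StrongDual ℝ X) f α := by
  obtain ⟨x, hx, hfx⟩ := f.exists_lt_apply_of_lt_opNorm (r := 1 - α) (by linarith)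
  rw [Real.norm_eq_abs] at hfx
  rcases lt_abs.1 hfx with h | h
  · exact ⟨x, (NormedSpace.double_dual_bound ℝ X x).trans hx.le, by
      rwa [NormedSpace.dual_def]⟩
  · refine ⟨-x, (NormedSpace.double_dual_bound ℝ X (-x)).trans ?_, ?_⟩
    · rw [norm_neg]
      exact hx.le
    · rwa [NormedSpace.dual_def, map_neg]

/-- Every w*-denting point of the closed unit ball of the bidual `X**`
belongs to the canonical image of `X` in `X**`. -/
theorem wstar_denting_point_of_bidual_mem_canonical_image
    {X : Type*} [NormedAddCommGroup X] [NormedSpace ℝ X] [CompleteSpace X]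
    (F : StrongDual ℝ (StrongDual ℝ X))
    (hF : IsWStarDentingPoint (X := StrongDual ℝ X) F) :
    ∃ x : X, NormedSpace.inclusionInDoubleDual ℝ X x = F := by
  have hclosed : IsClosed (Set.range (NormedSpace.inclusionInDoubleDual ℝ X)) := by
    have hiso : Isometry (NormedSpace.inclusionInDoubleDual ℝ X) :=
      (NormedSpace.inclusionInDoubleDualLi ℝ (E := X)).isometry
    exact hiso.isClosedEmbedding.isClosed_range
  refine hclosed.closure_subset ((Metric.mem_closure_range_iff
    (α := StrongDual ℝ (StrongDual ℝ X))).2 fun ε hε => ?_)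
  obtain ⟨f, α, hf, hα, hFmem, hdiam⟩ := hF.2 ε hε
  obtain ⟨x, hx⟩ := exists_inclusionInDoubleDual_mem_wStarSlice hf hα
  exact ⟨x, (Metric.dist_le_diam_of_mem (isBounded_wStarSlice f α) hFmem hx).trans_lt hdiam⟩
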